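/- For any binary strings w and p such that Φ(p) halts with output w and l(p) ≤ K(w) + O(1), one has w* → p: there is a fixed program of length O(1) that computes p from a shortest program w* for w. -/

import Mathlib

open scoped BigOperators
open scoped Classical

/-- The standard bijection between natural numbers and finite binary strings
(`ε ↦ 0`, `0 ↦ 1`, `1 ↦ 2`, `00 ↦ 3`, ...), inverse direction. -/
def strOfNat (n : ℕ) : List Bool := (n + 1).bits.dropLast

/-- Base-2 tetration: `1, 2, 2^2, 2^(2^2), ...`. -/
def tetr : ℕ → ℕ
  | 0 => 1
  | k + 1 => 2 ^ tetr k

/-- The super-logarithm, the inverse of base-2 tetration. -/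
noncomputable def slog (x : ℕ) : ℕ := sSup {k | tetr k ≤ x}

noncomputable section

/-- A machine given by a computable, monotone (in time) stepwise evaluation function
`step t p y n` : time `t`, program `p`, condition `y`, length parameter `n`
(the length parameter is always available). -/
structure Machine where
  step : ℕ → List Bool → ℕ → ℕ → Option ℕ
  computable_step :
    Computable fun q : (ℕ × List Bool) × ℕ × ℕ => step q.1.1 q.1.2 q.2.1 q.2.2
  mono : ∀ {t t' : ℕ} {p : List Bool} {y n v : ℕ}, t ≤ t' →
      step t p y n = some v → step t' p y n = some v

namespace Machine

variable (M : Machine)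

/-- `M(p|y,n) ↓ = v`. -/
def Outputs (p : List Bool) (y n v : ℕ) : Prop := ∃ t, M.step t p y n = some v

/-- `M(p|y,n) ↓`. -/
def HaltsOn (p : List Bool) (y n : ℕ) : Prop := ∃ v, M.Outputs p y n v

/-- the domain of `M` is prefix-free (for every condition). -/
def PrefixFree : Prop :=
  ∀ {p q : List Bool} {y n : ℕ}, M.HaltsOn p y n → M.HaltsOn q y n → p <+: q → p = q

/-- Kolmogorov complexity with respect to `M` (prefix-free complexity `K` when `M` is an
optimal prefix-free interpreter, plain complexity `C` when `M` is an optimal plain machine). -/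
def C (x y n : ℕ) : ℕ := sInf {l | ∃ p : List Bool, p.length = l ∧ M.Outputs p y n x}

/-- Time-bounded Kolmogorov complexity (`⊤` if no program produces `x` within time `t`). -/
def Ct (t x y n : ℕ) : ℕ∞ :=
  sInf {l : ℕ∞ | ∃ p : List Bool, (p.length : ℕ∞) = l ∧ M.step t p y n = some x}

/-- every value has a program, for every condition. -/
def Total : Prop := ∀ x y n, ∃ p : List Bool, M.Outputs p y n x

/-- `M` is an optimal universal prefix-free interpreter. -/
def POptimal : Prop := M.PrefixFree ∧ M.Total ∧
  ∀ N : Machine, N.PrefixFree → ∃ c, ∀ (p : List Bool) (y n v : ℕ),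
    N.Outputs p y n v → M.C v y n ≤ p.length + c

/-- `M` is an optimal universal plain machine. -/
def Optimal : Prop := M.Total ∧
  ∀ N : Machine, ∃ c, ∀ (p : List Bool) (y n v : ℕ),
    N.Outputs p y n v → M.C v y n ≤ p.length + c

/-- `p` is a shortest program for `x` (given `y`, `n`) on `M`. -/
def ShortestProg (p : List Bool) (x y n : ℕ) : Prop :=
  M.Outputs p y n x ∧ p.length = M.C x y n

/-- `u → v`: some program of length at most `c` computes `v` from `u` (and `n`). -/
def Computes (c u n v : ℕ) : Prop := ∃ q : List Bool, q.length ≤ c ∧ M.Outputs q u n v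

/-- `Ω^n_t`. -/
def OmegaT (n t : ℕ) : ℝ :=
  ∑' p : List Bool,
    if ∃ v, v < 2 ^ n ∧ M.step t p 0 n = some v then (2 : ℝ) ^ (-(p.length : ℤ)) else 0

/-- `Ω^n`. -/
def Omega (n : ℕ) : ℝ :=
  ∑' p : List Bool,
    if ∃ v, v < 2 ^ n ∧ M.Outputs p 0 n v then (2 : ℝ) ^ (-(p.length : ℤ)) else 0

/-- `t_k = min { t : Ω^n − Ω^n_t ≤ 2^{−k} }`. -/
def tk (n k : ℕ) : ℕ := sInf {t | M.Omega n - M.OmegaT n t ≤ (2 : ℝ) ^ (-(k : ℤ))}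

/-- the computational `m`-depth `k_x` of `x ∈ 2^n`, with additive constant `d`:
`k_x = min { k : K_{t_k}(x) ≤ K(x) + d }`. -/
def mdepth (d n x : ℕ) : ℕ :=
  sInf {k | ∃ p : List Bool, p.length ≤ M.C x 0 n + d ∧ M.step (M.tk n k) p 0 n = some x}

/-- `Ω^{n,j}`: the first `j` bits of the binary expansion of `Ω^n`, as a natural number. -/
def OmegaBits (n j : ℕ) : ℕ := ⌊M.Omega n * 2 ^ j⌋₊

/-- `H^{n,j}`: the first `j` bits of the Halting sequence `H^n` of `M`, as a natural number. -/
def Hbits (n j : ℕ) : ℕ :=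
  ∑ i ∈ Finset.range j, if M.HaltsOn (strOfNat i) 0 n then 2 ^ i else 0

/-- The Busy Beaver function of `M`: `BB(k) = max { M(p) : p ∈ 2^k, M(p)↓ }`. -/
def BB (n k : ℕ) : ℕ := sSup {v | ∃ p : List Bool, p.length = k ∧ M.Outputs p 0 n v}

end Machine

/-- `p` is a program on `M` computing the rational-valued function `P`. -/
def ProgForProb (M : Machine) (p : List Bool) (P : ℕ → ℚ) (n : ℕ) : Prop :=
  ∀ y, M.Outputs p y n (Encodable.encode (P y))

/-- Complexity of the function `P` with respect to `M`. -/
noncomputable def KProb (M : Machine) (n : ℕ) (P : ℕ → ℚ) : ℕ :=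
  sInf {l | ∃ p : List Bool, p.length = l ∧ ProgForProb M p P n}

/-- a (length conditional) semimeasure on `2^n`. -/
def IsSemimeasure (n : ℕ) (P : ℕ → ℚ) : Prop :=
  (∀ y, 0 ≤ P y) ∧ ∑ y ∈ Finset.range (2 ^ n), P y ≤ 1

/-- `p` is a program on `M` computing the partial function `F` (on binary strings). -/
def ProgForFun (M : Machine) (p : List Bool) (F : List Bool → Option ℕ) (n : ℕ) : Prop :=
  ∀ d v, F d = some v ↔ M.Outputs p (Encodable.encode d) n v

/-- `F` has prefix-free domain. -/
def PrefixFreeFun (F : List Bool → Option ℕ) : Prop :=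
  ∀ d d', (F d).isSome → (F d').isSome → d <+: d' → d = d'

/-- Complexity of the partial function `F` with respect to `M`. -/
noncomputable def KFun (M : Machine) (n : ℕ) (F : List Bool → Option ℕ) : ℕ :=
  sInf {l | ∃ p : List Bool, p.length = l ∧ ProgForFun M p F n}

/-- sufficient set statistic: `x ∈ S` and `K(S) + log|S| = K(x) ± c`. -/
def SufficientSet (Φ : Machine) (c n x : ℕ) (S : Finset ℕ) : Prop :=
  x ∈ S ∧ S ⊆ Finset.range (2 ^ n) ∧
    Nat.dist (Φ.C (Encodable.encode S) 0 n + Nat.log 2 S.card) (Φ.C x 0 n) ≤ c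

/-- sufficient probabilistic statistic: `P` computable semimeasure, `K(P) − log P(x) = K(x) ± c`. -/
def SufficientProb (Φ : Machine) (c n x : ℕ) (P : ℕ → ℚ) : Prop :=
  IsSemimeasure n P ∧ (∃ p, ProgForProb Φ p P n) ∧
    |(KProb Φ n P : ℝ) - Real.logb 2 (P x) - (Φ.C x 0 n : ℝ)| ≤ c

/-- sufficient function statistic: `F` computable prefix-free,
`K(F) + l(d) = K(x) ± c` for some `d` with `F(d) = x`. -/
def SufficientFun (Φ : Machine) (c n x : ℕ) (F : List Bool → Option ℕ) : Prop :=
  PrefixFreeFun F ∧ (∃ p, ProgForFun Φ p F n) ∧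
    ∃ d, F d = some x ∧ Nat.dist (KFun Φ n F + d.length) (Φ.C x 0 n) ≤ c

/-- minimal sufficient set statistic (within the constant `c`). -/
def MinimalSufficientSet (Φ : Machine) (c n x : ℕ) (S : Finset ℕ) : Prop :=
  SufficientSet Φ c n x S ∧ ∀ S' : Finset ℕ, SufficientSet Φ c n x S' →
    Φ.C (Encodable.encode S) 0 n ≤ Φ.C (Encodable.encode S') 0 n + c

/-- `l^S_x`: the complexity of a minimal sufficient set statistic. -/
noncomputable def lSet (Φ : Machine) (c n x : ℕ) : ℕ :=
  sInf {l | ∃ S : Finset ℕ, SufficientSet Φ c n x S ∧ Φ.C (Encodable.encode S) 0 n = l}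

/-- `l^P_x`: the complexity of a minimal sufficient probabilistic statistic. -/
noncomputable def lProb (Φ : Machine) (c n x : ℕ) : ℕ :=
  sInf {l | ∃ P : ℕ → ℚ, SufficientProb Φ c n x P ∧ KProb Φ n P = l}

/-- `l^F_x`: the complexity of a minimal sufficient function statistic. -/
noncomputable def lFun (Φ : Machine) (c n x : ℕ) : ℕ :=
  sInf {l | ∃ F : List Bool → Option ℕ, SufficientFun Φ c n x F ∧ KFun Φ n F = l}

/-- weak sufficient set statistic: `C(S) + log|S| = K(x|C(S)) ± c`
(`Φ` the prefix-free interpreter, `Ψ` the plain machine). -/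
def WeakSufficientSet (Φ Ψ : Machine) (c n x : ℕ) (S : Finset ℕ) : Prop :=
  x ∈ S ∧ S ⊆ Finset.range (2 ^ n) ∧
    Nat.dist (Ψ.C (Encodable.encode S) 0 n + Nat.log 2 S.card)
      (Φ.C x (Ψ.C (Encodable.encode S) 0 n) n) ≤ c

/-- weak sufficient probabilistic statistic: `C(P) − log P(x) = K(x|C(P)) ± c`. -/
def WeakSufficientProb (Φ Ψ : Machine) (c n x : ℕ) (P : ℕ → ℚ) : Prop :=
  IsSemimeasure n P ∧ (∃ p, ProgForProb Ψ p P n) ∧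
    |(KProb Ψ n P : ℝ) - Real.logb 2 (P x) - (Φ.C x (KProb Ψ n P) n : ℝ)| ≤ c

/-- weak sufficient function statistic: `C(F) + l(d) = K(x|C(F)) ± c` for some `d`, `F(d) = x`. -/
def WeakSufficientFun (Φ Ψ : Machine) (c n x : ℕ) (F : List Bool → Option ℕ) : Prop :=
  (∃ p, ProgForFun Ψ p F n) ∧
    ∃ d, F d = some x ∧ Nat.dist (KFun Ψ n F + d.length) (Φ.C x (KFun Ψ n F) n) ≤ c

/-- typical semimeasure: `−log P(x) = K(x|P*) ± c`, `P*` a shortest plain description of `P`. -/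
def TypicalProb (Φ Ψ : Machine) (c n x : ℕ) (P : ℕ → ℚ) : Prop :=
  IsSemimeasure n P ∧ (∃ p, ProgForProb Ψ p P n) ∧
    ∀ p : List Bool, ProgForProb Ψ p P n → p.length = KProb Ψ n P →
      |(-Real.logb 2 (P x)) - (Φ.C x (Encodable.encode p) n : ℝ)| ≤ c

/-- the `BB`-depth `k'_x` with additive constant `d`:
`k'_x = min { k : K_{BB(k)}(x|k) ≤ K(x|k) + d }`. -/
noncomputable def kBB (Φ Ψ : Machine) (d n x : ℕ) : ℕ :=
  sInf {k | ∃ p : List Bool, p.length ≤ Φ.C x k n + d ∧ Φ.step (Ψ.BB n k) p k n = some x}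

/-- The explicit weak sufficient statistic `P'_x`, with constants `d` (for `k'_x`),
`c` (scaling) and `c₂` (difference threshold):
`P'_x(y) = 2^{−K_{BB(k'_x)}(y|k'_x) + k'_x − c}` when
`K_{BB(k'_x)}(y|k'_x)` and `K_{BB(k'_x−1)}(y|k'_x)` differ by more than `c₂`, else `0`. -/
noncomputable def Pprime (Φ Ψ : Machine) (d c c₂ n x : ℕ) (y : ℕ) : ℚ :=
  if Φ.Ct (Ψ.BB n (kBB Φ Ψ d n x)) y (kBB Φ Ψ d n x) n + (c₂ : ℕ∞) <
      Φ.Ct (Ψ.BB n (kBB Φ Ψ d n x - 1)) y (kBB Φ Ψ d n x) n then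
    (2 : ℚ) ^ (kBB Φ Ψ d n x) /
      2 ^ (c + (Φ.Ct (Ψ.BB n (kBB Φ Ψ d n x)) y (kBB Φ Ψ d n x) n).toNat)
  else 0

/-- A prefix-free oracle machine: `step t p y n w` where `w` is the length-`t` initial
segment of the oracle which may be queried within `t` steps. -/
structure OracleMachine where
  step : ℕ → List Bool → ℕ → ℕ → List Bool → Option ℕ
  computable_step :
    Computable fun q : ((ℕ × List Bool) × ℕ × ℕ) × List Bool =>
      step q.1.1.1 q.1.1.2 q.1.2.1 q.1.2.2 q.2
  mono : ∀ {t t' : ℕ} {p : List Bool} {y n v : ℕ} (O : ℕ → Bool), t ≤ t' →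
      step t p y n (List.ofFn fun i : Fin t => O i) = some v →
      step t' p y n (List.ofFn fun i : Fin t' => O i) = some v

namespace OracleMachine

variable (M : OracleMachine) (O : ℕ → Bool)

def Outputs (p : List Bool) (y n v : ℕ) : Prop :=
  ∃ t, M.step t p y n (List.ofFn fun i : Fin t => O i) = some v

def HaltsOn (p : List Bool) (y n : ℕ) : Prop := ∃ v, M.Outputs O p y n v

def PrefixFree : Prop :=
  ∀ {p q : List Bool} {y n : ℕ}, M.HaltsOn O p y n → M.HaltsOn O q y n → p <+: q → p = q

/-- oracle Kolmogorov complexity `K^O`. -/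
def C (x y n : ℕ) : ℕ := sInf {l | ∃ p : List Bool, p.length = l ∧ M.Outputs O p y n x}

def Total : Prop := ∀ x y n, ∃ p : List Bool, M.Outputs O p y n x

/-- `M` is an optimal universal prefix-free machine relative to the oracle `O`. -/
def POptimal : Prop := M.PrefixFree O ∧ M.Total O ∧
  ∀ N : OracleMachine, N.PrefixFree O → ∃ c, ∀ (p : List Bool) (y n v : ℕ),
    N.Outputs O p y n v → M.C O v y n ≤ p.length + c

end OracleMachine

/-- The Halting sequence of `Φ` as a single oracle (pairing index and length parameter). -/
noncomputable def Hseq (Φ : Machine) : ℕ → Bool :=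
  fun i => decide (Φ.HaltsOn (strOfNat i.unpair.1) 0 i.unpair.2)

end

/-- The number whose binary expansion, most significant bit first, is the given string. -/
def bitVal (q : List Bool) : ℕ := q.foldl (fun a b => 2 * a + b.toNat) 0

lemma bitVal_concat (q : List Bool) (b : Bool) : bitVal (q ++ [b]) = 2 * bitVal q + b.toNat := by
  simp [bitVal]

lemma bitVal_append (q s : List Bool) : bitVal (q ++ s) = bitVal q * 2 ^ s.length + bitVal s := by
  induction s using List.reverseRecOn with
  | nil => simp [bitVal]
  | append_singleton s b ih =>
    rw [← List.append_assoc, bitVal_concat, bitVal_concat, ih, List.length_append,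
      List.length_singleton, pow_succ]
    ring

lemma bitVal_lt (q : List Bool) : bitVal q < 2 ^ q.length := by
  induction q using List.reverseRecOn with
  | nil => simp [bitVal]
  | append_singleton s b ih =>
    rw [bitVal_concat, List.length_append, List.length_singleton, pow_succ]
    have := b.toNat_lt
    omega

lemma exists_bitVal_eq (k x : ℕ) (hx : x < 2 ^ k) :
    ∃ q : List Bool, q.length = k ∧ bitVal q = x := by
  induction k generalizing x with
  | zero => exact ⟨[], rfl, by simp at hx; simp [bitVal, hx]⟩
  | succ k ih =>
    obtain ⟨q, hq, hv⟩ := ih (x / 2) (by rw [pow_succ] at hx; omega)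
    refine ⟨q ++ [decide (x % 2 = 1)], by simp [hq], ?_⟩
    rw [bitVal_concat, hv]
    by_cases h : x % 2 = 1 <;> simp [h] <;> omega

lemma bitVal_primrec : Primrec bitVal := by
  refine Primrec.list_foldl (h := fun (_ : List Bool) (s : ℕ × Bool) => 2 * s.1 + s.2.toNat)
    Primrec.id (Primrec.const 0) ?_
  refine Primrec.nat_add.comp (Primrec.nat_mul.comp (Primrec.const 2)
    (Primrec.fst.comp Primrec.snd)) ?_
  exact (Primrec.dom_bool Bool.toNat).comp (Primrec.snd.comp Primrec.snd)

lemma nat_pow_primrec : Primrec₂ ((· ^ ·) : ℕ → ℕ → ℕ) :=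
  Primrec₂.unpaired'.1 Nat.Primrec.pow

lemma Computable.sum_range {α : Type*} [Primcodable α] {f : α → ℕ → ℕ} {k : α → ℕ}
    (hf : Computable₂ f) (hk : Computable k) :
    Computable fun a => ∑ i ∈ Finset.range (k a), f a i := by
  refine (Computable.nat_rec (h := fun a s => s.2 + f a s.1) hk (Computable.const 0) ?_).of_eq ?_
  · exact Primrec.nat_add.to_comp.comp (Computable.snd.comp Computable.snd)
      (hf.comp Computable.fst (Computable.fst.comp Computable.snd))
  · intro a
    induction k a with
    | zero => simp
    | succ n ih => rw [Finset.sum_range_succ, ← ih]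

lemma Computable.ite_eq {α β σ : Type*} [Primcodable α] [Primcodable β] [DecidableEq β]
    [Primcodable σ] {a b : α → β} {f g : α → σ} (ha : Computable a) (hb : Computable b)
    (hf : Computable f) (hg : Computable g) :
    Computable fun x => if a x = b x then f x else g x :=
  (Computable.cond (Primrec.eq.decide.to_comp.comp ha hb) hf hg).of_eq fun x => by
    by_cases h : a x = b x <;> simp [h]

lemma Computable.ite_le {α σ : Type*} [Primcodable α]
    [Primcodable σ] {a b : α → ℕ} {f g : α → σ} (ha : Computable a) (hb : Computable b)
    (hf : Computable f) (hg : Computable g) :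
    Computable fun x => if a x ≤ b x then f x else g x :=
  (Computable.cond (Primrec.nat_le.decide.to_comp.comp ha hb) hf hg).of_eq fun x => by
    by_cases h : a x ≤ b x <;> simp [h]

namespace Machine

/-- The first value among `g 0, …, g (t - 1)` that is defined. -/
def firstBelow (g : ℕ → Option ℕ) (t : ℕ) : Option ℕ :=
  Nat.rec none (fun i acc => acc <|> g i) t

lemma firstBelow_succ (g : ℕ → Option ℕ) (t : ℕ) :
    firstBelow g (t + 1) = (firstBelow g t <|> g t) := rfl

lemma firstBelow_mono {g : ℕ → Option ℕ} {t t' v : ℕ} (h : t ≤ t')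
    (hv : firstBelow g t = some v) : firstBelow g t' = some v := by
  induction h with
  | refl => exact hv
  | step _ ih => rw [firstBelow_succ, ih]; rfl

lemma exists_of_firstBelow {g : ℕ → Option ℕ} {t v : ℕ} (hv : firstBelow g t = some v) :
    ∃ i, g i = some v := by
  induction t with
  | zero => simp [firstBelow] at hv
  | succ t ih =>
    rw [firstBelow_succ] at hv
    cases h : firstBelow g t with
    | none => rw [h] at hv; exact ⟨t, by simpa using hv⟩
    | some w => rw [h] at hv; exact ih (by rw [h]; simpa using hv)

lemma firstBelow_computable {g : List Bool → ℕ → ℕ → ℕ → Option ℕ}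
    (hg : Computable fun q : (List Bool × ℕ × ℕ) × ℕ => g q.1.1 q.1.2.1 q.1.2.2 q.2) :
    Computable fun q : (ℕ × List Bool) × ℕ × ℕ =>
      firstBelow (g q.1.2 q.2.1 q.2.2) q.1.1 := by
  have hh : Computable₂ fun (q : (ℕ × List Bool) × ℕ × ℕ) (s : ℕ × Option ℕ) =>
      s.2 <|> g q.1.2 q.2.1 q.2.2 s.1 := by
    have h1 : Computable fun r : ((ℕ × List Bool) × ℕ × ℕ) × ℕ × Option ℕ => r.2.2 :=
      Computable.snd.comp Computable.snd
    have h2 : Computable fun r : ((ℕ × List Bool) × ℕ × ℕ) × ℕ × Option ℕ =>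
        (((r.1.1.2, r.1.2), r.2.1) : (List Bool × ℕ × ℕ) × ℕ) :=
      Computable.pair (Computable.pair
        (Computable.snd.comp (Computable.fst.comp Computable.fst))
        (Computable.snd.comp Computable.fst)) (Computable.fst.comp Computable.snd)
    have h3 := hg.comp h2
    exact Primrec.option_orElse.to_comp.comp h1 h3
  exact Computable.nat_rec (Computable.fst.comp Computable.fst) (Computable.const none) hh

/-- The machine that searches for the first defined value of a computable sequence. -/
def search (g : List Bool → ℕ → ℕ → ℕ → Option ℕ)
    (hg : Computable fun q : (List Bool × ℕ × ℕ) × ℕ => g q.1.1 q.1.2.1 q.1.2.2 q.2) :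
    Machine where
  step t p y n := firstBelow (g p y n) t
  computable_step := firstBelow_computable hg
  mono h hv := firstBelow_mono h hv

lemma exists_of_search_outputs {g : List Bool → ℕ → ℕ → ℕ → Option ℕ} {hg} {p : List Bool}
    {y n v : ℕ} (h : (search g hg).Outputs p y n v) : ∃ i, g p y n i = some v :=
  let ⟨_, ht⟩ := h
  exists_of_firstBelow ht

lemma search_outputs_of_unique {g : List Bool → ℕ → ℕ → ℕ → Option ℕ} {hg} {p : List Bool}
    {y n v : ℕ} (h : ∃ i, g p y n i = some v) (hu : ∀ i u, g p y n i = some u → u = v) :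
    (search g hg).Outputs p y n v := by
  obtain ⟨i, hi⟩ := h
  refine ⟨i + 1, ?_⟩
  change firstBelow (g p y n) (i + 1) = some v
  rw [firstBelow_succ]
  cases h : firstBelow (g p y n) i with
  | none => simpa using hi
  | some w =>
    obtain ⟨k, hk⟩ := exists_of_firstBelow h
    rw [hu k w hk]; rfl

variable (M : Machine)

/-- `event n e = some (p, v)` when `e` codes `p` together with the first time at which
`M(p|0,n)` outputs `v`; an enumeration without repetition of the halting programs. -/
def event (n e : ℕ) : Option (List Bool × ℕ) :=
  (Encodable.decode₂ (List Bool) e.unpair.2).bind fun p =>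
    if e.unpair.1 ≤ 0 then (M.step e.unpair.1 p 0 n).map fun v => (p, v)
    else if M.step (e.unpair.1 - 1) p 0 n = none then
      (M.step e.unpair.1 p 0 n).map fun v => (p, v)
    else none

lemma step_computable {α : Type*} [Primcodable α] {t : α → ℕ} {p : α → List Bool} {y n : α → ℕ}
    (ht : Computable t) (hp : Computable p) (hy : Computable y) (hn : Computable n) :
    Computable fun a => M.step (t a) (p a) (y a) (n a) :=
  M.computable_step.comp (Computable.pair (Computable.pair ht hp) (Computable.pair hy hn))

lemma event_computable : Computable₂ M.event := by
  have hu : Computable fun q : (ℕ × ℕ) × List Bool => q.1.2.unpair.1 :=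
    Computable.fst.comp (Computable.unpair.comp (Computable.snd.comp Computable.fst))
  have hn : Computable fun q : (ℕ × ℕ) × List Bool => q.1.1 := Computable.fst.comp Computable.fst
  have hs : Computable fun q : (ℕ × ℕ) × List Bool =>
      (M.step q.1.2.unpair.1 q.2 0 q.1.1).map fun v => (q.2, v) :=
    Computable.option_map (M.step_computable hu Computable.snd (Computable.const 0) hn)
      (Computable.pair (Computable.snd.comp Computable.fst) Computable.snd)
  refine Computable.option_bind (Primrec.decode₂.to_comp.comp (Computable.snd.comp
    (Computable.unpair.comp Computable.snd))) ?_
  refine Computable.ite_le hu (Computable.const 0) hs ?_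
  refine Computable.ite_eq (M.step_computable (Computable.pred.comp hu) Computable.snd
    (Computable.const 0) hn) (Computable.const none) hs (Computable.const none)

variable {M}

lemma event_eq_some_iff {n e v : ℕ} {p : List Bool} :
    M.event n e = some (p, v) ↔ Encodable.encode p = e.unpair.2 ∧
      M.step e.unpair.1 p 0 n = some v ∧ ∀ t < e.unpair.1, M.step t p 0 n = none := by
  have key (t : ℕ) (p : List Bool) : (if t ≤ 0 then (M.step t p 0 n).map fun v => (p, v)
      else if M.step (t - 1) p 0 n = none then (M.step t p 0 n).map fun v => (p, v)
      else none) = if ∀ s < t, M.step s p 0 n = none then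
        (M.step t p 0 n).map fun v => (p, v) else none := by
    rcases t with _ | t
    · simp
    · have : (∀ s < t + 1, M.step s p 0 n = none) ↔ M.step t p 0 n = none := by
        refine ⟨fun h => h t t.lt_succ_self, fun h s hs => ?_⟩
        by_contra hc
        obtain ⟨u, hu⟩ := Option.ne_none_iff_exists'.1 hc
        rw [M.mono (Nat.le_of_lt_succ hs) hu] at h
        cases h
      rw [if_congr this rfl rfl]
      simp
  simp only [event, key, Option.bind_eq_some_iff, ← Encodable.mem_decode₂, Option.mem_def]
  constructor
  · rintro ⟨p', hp', h⟩
    split_ifs at h with hs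
    simp only [Option.map_eq_some_iff, Prod.mk.injEq] at h
    obtain ⟨v', hv', rfl, rfl⟩ := h
    exact ⟨hp', hv', hs⟩
  · rintro ⟨hp, hv, hs⟩
    exact ⟨p, hp, by rw [if_pos hs, hv]; rfl⟩

lemma Outputs.unique {p : List Bool} {y n v v' : ℕ} (h : M.Outputs p y n v)
    (h' : M.Outputs p y n v') : v = v' := by
  obtain ⟨t, ht⟩ := h
  obtain ⟨t', ht'⟩ := h'
  have h1 := M.mono (le_max_left t t') ht
  rw [M.mono (le_max_right t t') ht'] at h1
  exact (Option.some.inj h1).symm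

lemma outputs_of_event {n e v : ℕ} {p : List Bool} (h : M.event n e = some (p, v)) :
    M.Outputs p 0 n v :=
  ⟨_, (event_eq_some_iff.1 h).2.1⟩

lemma exists_event {n v : ℕ} {p : List Bool} (h : M.Outputs p 0 n v) :
    ∃ e, M.event n e = some (p, v) := by
  refine ⟨Nat.pair (Nat.find h) (Encodable.encode p), event_eq_some_iff.2 ?_⟩
  simp only [Nat.unpair_pair]
  refine ⟨trivial, Nat.find_spec h, fun t ht => ?_⟩
  by_contra hc
  obtain ⟨u, hu⟩ := Option.ne_none_iff_exists'.1 hc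
  exact Nat.find_min h ht (Outputs.unique ⟨t, hu⟩ h ▸ hu)

lemma event_inj {n e e' v v' : ℕ} {p : List Bool} (h : M.event n e = some (p, v))
    (h' : M.event n e' = some (p, v')) : e = e' := by
  obtain ⟨hp, hv, hs⟩ := event_eq_some_iff.1 h
  obtain ⟨hp', hv', hs'⟩ := event_eq_some_iff.1 h'
  have h1 : e.unpair.1 = e'.unpair.1 := by
    rcases lt_trichotomy e.unpair.1 e'.unpair.1 with h | h | h
    · rw [hs' _ h] at hv; cases hv
    · exact h
    · rw [hs _ h] at hv'; cases hv'
  rw [← Nat.pair_unpair e, ← Nat.pair_unpair e', h1, ← hp, ← hp']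

lemma length_le_of_event {n e v : ℕ} {p : List Bool} (h : M.event n e = some (p, v)) :
    p.length ≤ e := by
  refine (Encodable.length_le_encode p).trans ?_
  rw [(event_eq_some_iff.1 h).1]
  exact Nat.unpair_right_le e

end Machine

/-- `r + 1` if this is a power of two, and `0` otherwise. -/
def pow2Weight (r : ℕ) : ℕ := if 2 ^ r % (r + 1) = 0 then r + 1 else 0

lemma pow2Weight_of_eq {r i : ℕ} (h : r + 1 = 2 ^ i) : pow2Weight r = r + 1 := by
  have hi : i ≤ r := by
    have := i.lt_two_pow_self
    omega
  rw [pow2Weight, if_pos]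
  rw [h]
  exact Nat.mod_eq_zero_of_dvd (pow_dvd_pow 2 hi)

lemma exists_of_pow2Weight_ne_zero {r : ℕ} (h : pow2Weight r ≠ 0) : ∃ i, r + 1 = 2 ^ i := by
  rw [pow2Weight] at h
  split_ifs at h with hd
  · obtain ⟨i, -, hi⟩ := (Nat.dvd_prime_pow Nat.prime_two).1 (Nat.dvd_of_mod_eq_zero hd)
    exact ⟨i, hi⟩
  · exact absurd rfl h

lemma sum_pow2Weight_le (R : ℕ) : ∑ r ∈ Finset.range R, pow2Weight r ≤ 2 * R := by
  suffices h : ∀ R, ∑ r ∈ Finset.range (R + 1), pow2Weight r + 1 = 2 ^ (Nat.log 2 (R + 1) + 1) by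
    rcases R with _ | R
    · simp
    · have h1 := h R
      have h2 := Nat.pow_log_le_self 2 (Nat.succ_ne_zero R)
      rw [pow_succ] at h1
      simp only [Nat.succ_eq_add_one] at h2
      omega
  intro R
  induction R with
  | zero => simp [pow2Weight]
  | succ R ih =>
    rw [Finset.sum_range_succ]
    by_cases h : pow2Weight (R + 1) = 0
    · rw [h, add_zero, ih]
      congr 2
      refine (Nat.log_eq_of_pow_le_of_lt_pow ?_ ?_).symm
      · exact (Nat.pow_log_le_self 2 (Nat.succ_ne_zero R)).trans (Nat.le_succ _)
      · have h1 : R + 1 < 2 ^ (Nat.log 2 (R + 1) + 1) :=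
          Nat.lt_pow_succ_log_self Nat.one_lt_two _
        refine lt_of_le_of_ne h1 fun hc => ?_
        rw [pow2Weight_of_eq hc] at h
        omega
    · obtain ⟨i, hi⟩ := exists_of_pow2Weight_ne_zero h
      rw [pow2Weight_of_eq hi, hi, Nat.log_pow Nat.one_lt_two]
      rcases i with _ | i
      · simp at hi
      have hl : Nat.log 2 (R + 1) = i := by
        refine Nat.log_eq_of_pow_le_of_lt_pow ?_ ?_
        · have := Nat.one_le_two_pow (n := i)
          rw [pow_succ] at hi
          omega
        · omega
      rw [hl] at ih
      rw [pow_succ 2 (i + 1)]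
      omega

lemma pow2Weight_primrec : Primrec pow2Weight := by
  refine Primrec.ite (Primrec.eq.comp (Primrec.nat_mod.comp
    (nat_pow_primrec.comp (Primrec.const 2) Primrec.id) Primrec.succ) (Primrec.const 0))
    Primrec.succ (Primrec.const 0)

lemma uniquelyDecodable_of_prefixFree {α : Type*} {S : Set (List α)} (h0 : [] ∉ S)
    (h : ∀ p ∈ S, ∀ q ∈ S, p <+: q → p = q) : InformationTheory.UniquelyDecodable S := by
  intro L₁
  induction L₁ with
  | nil =>
    rintro (_ | ⟨b, L₂⟩) - h2 he
    · rfl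
    · have : b = [] := by
        simp only [List.flatten_cons, List.flatten_nil, List.nil_eq, List.append_eq_nil_iff] at he
        exact he.1
      exact absurd (this ▸ h2 b (by simp)) h0
  | cons a L₁ ih =>
    rintro (_ | ⟨b, L₂⟩) h1 h2 he
    · have : a = [] := by
        simp only [List.flatten_cons, List.flatten_nil, List.append_eq_nil_iff] at he
        exact he.1
      exact absurd (this ▸ h1 a (by simp)) h0
    · have ha := h1 a (by simp)
      have hb := h2 b (by simp)
      simp only [List.flatten_cons] at he
      have hab : a = b := by
        rcases List.prefix_or_prefix_of_prefix (List.prefix_append a L₁.flatten)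
          (he ▸ List.prefix_append b L₂.flatten) with hp | hp
        · exact h a ha b hb hp
        · exact (h b hb a ha hp).symm
      subst hab
      rw [ih L₂ (fun w hw => h1 w (by simp [hw])) (fun w hw => h2 w (by simp [hw]))
        (List.append_cancel_left he)]

/-- Kraft's inequality for prefix-free sets of binary strings. -/
lemma kraft_of_prefixFree (S : Finset (List Bool))
    (h : ∀ p ∈ S, ∀ q ∈ S, p <+: q → p = q) :
    ∑ p ∈ S, (1 / 2 : ℝ) ^ p.length ≤ 1 := by
  by_cases h0 : [] ∈ S
  · have : S = {[]} := Finset.eq_singleton_iff_unique_mem.2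
      ⟨h0, fun q hq => (h _ h0 q hq List.nil_prefix).symm⟩
    simp [this]
  · have := InformationTheory.kraft_mcmillan_inequality (S := S)
      (uniquelyDecodable_of_prefixFree (by simpa using h0) (by simpa using h))
    simpa using this

namespace Machine

variable (M : Machine)

/-- The length and the value of the `e`-th halting program. -/
def eventKey (n e : ℕ) : Option (ℕ × ℕ) := (M.event n e).map fun a => (a.1.length, a.2)

/-- The number of events before `e` with length and value `k`. -/
def rank (n : ℕ) (k : ℕ × ℕ) (e : ℕ) : ℕ :=
  ∑ i ∈ Finset.range e, if M.eventKey n i = some k then 1 else 0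

/-- The weight requested at `e` for the value of the `e`-th halting program. -/
noncomputable def eventWeight (n e : ℕ) : ℝ :=
  match M.eventKey n e with
  | none => 0
  | some k => pow2Weight (M.rank n k e) * (1 / 2) ^ (k.1 + 1)

/-- The natural number `2 ^ (e + 1) * ∑ i < e, M.eventWeight n i`. -/
def startNum (n e : ℕ) : ℕ :=
  ∑ i ∈ Finset.range e, ((M.eventKey n i).map fun k =>
    pow2Weight (M.rank n k i) * 2 ^ (e - k.1)).getD 0

lemma eventKey_computable : Computable₂ M.eventKey :=
  Computable.option_map M.event_computable
    (Computable.pair (Computable.list_length.comp (Computable.fst.comp Computable.snd))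
      (Computable.snd.comp Computable.snd))

lemma rank_computable : Computable fun q : ℕ × (ℕ × ℕ) × ℕ => M.rank q.1 q.2.1 q.2.2 := by
  refine Computable.sum_range ?_ (Computable.snd.comp Computable.snd)
  exact Computable.ite_eq (M.eventKey_computable.comp (Computable.fst.comp Computable.fst)
    Computable.snd) (Computable.option_some.comp (Computable.fst.comp
      (Computable.snd.comp Computable.fst))) (Computable.const 1) (Computable.const 0)

lemma startNum_computable : Computable₂ M.startNum := by
  refine Computable.sum_range (α := ℕ × ℕ) ?_ Computable.snd
  refine Computable.option_getD (Computable.option_map (M.eventKey_computable.comp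
    (Computable.fst.comp Computable.fst) Computable.snd) ?_) (Computable.const 0)
  have hn : Computable fun q : ((ℕ × ℕ) × ℕ) × ℕ × ℕ => q.1.1.1 :=
    Computable.fst.comp (Computable.fst.comp Computable.fst)
  have he : Computable fun q : ((ℕ × ℕ) × ℕ) × ℕ × ℕ => q.1.1.2 :=
    Computable.snd.comp (Computable.fst.comp Computable.fst)
  have hi : Computable fun q : ((ℕ × ℕ) × ℕ) × ℕ × ℕ => q.1.2 :=
    Computable.snd.comp Computable.fst
  have hr := M.rank_computable.comp (Computable.pair hn (Computable.pair Computable.snd hi))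
  exact Primrec.nat_mul.to_comp.comp (pow2Weight_primrec.to_comp.comp hr)
    (nat_pow_primrec.to_comp.comp (Computable.const 2)
      (Primrec.nat_sub.to_comp.comp he (Computable.fst.comp Computable.snd)))

variable {M}

lemma rank_succ (n : ℕ) (k : ℕ × ℕ) (e : ℕ) :
    M.rank n k (e + 1) = M.rank n k e + if M.eventKey n e = some k then 1 else 0 :=
  Finset.sum_range_succ _ _

lemma rank_mono (n : ℕ) (k : ℕ × ℕ) : Monotone (M.rank n k) :=
  monotone_nat_of_le_succ fun e => by rw [rank_succ]; exact Nat.le_add_right _ _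

lemma rank_lt_rank {n e e' : ℕ} {k : ℕ × ℕ} (h : M.eventKey n e = some k) (hlt : e < e') :
    M.rank n k e < M.rank n k e' := by
  refine lt_of_lt_of_le ?_ (rank_mono n k hlt)
  simp [rank_succ, h]

lemma exists_rank_eq {n e r : ℕ} {k : ℕ × ℕ} (h : r < M.rank n k e) :
    ∃ i < e, M.eventKey n i = some k ∧ M.rank n k i = r := by
  induction e with
  | zero => simp [rank] at h
  | succ e ih =>
    by_cases hr : r < M.rank n k e
    · obtain ⟨i, hi, hk⟩ := ih hr
      exact ⟨i, by omega, hk⟩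
    · rw [rank_succ] at h
      split_ifs at h with hk
      · exact ⟨e, e.lt_succ_self, hk, by omega⟩
      · omega

lemma sum_rank (n : ℕ) (k : ℕ × ℕ) (f : ℕ → ℝ) (e : ℕ) :
    ∑ i ∈ Finset.range e with M.eventKey n i = some k, f (M.rank n k i) =
      ∑ r ∈ Finset.range (M.rank n k e), f r := by
  rw [Finset.sum_filter]
  induction e with
  | zero => simp [rank]
  | succ e ih =>
    rw [Finset.sum_range_succ, ih, rank_succ]
    split_ifs
    · rw [Finset.sum_range_succ]
    · simp

lemma eventKey_eq_some {n e : ℕ} {k : ℕ × ℕ} (h : M.eventKey n e = some k) :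
    ∃ p : List Bool, p.length = k.1 ∧ M.event n e = some (p, k.2) := by
  simp only [eventKey, Option.map_eq_some_iff] at h
  obtain ⟨⟨p, v⟩, h, rfl⟩ := h
  exact ⟨p, rfl, h⟩

lemma eventWeight_nonneg (n e : ℕ) : 0 ≤ M.eventWeight n e := by
  unfold eventWeight
  split <;> positivity

lemma eventWeight_eq {n e : ℕ} {k : ℕ × ℕ} (h : M.eventKey n e = some k) :
    M.eventWeight n e = pow2Weight (M.rank n k e) * (1 / 2) ^ (k.1 + 1) := by
  simp [eventWeight, h]

lemma startNum_eq (n e : ℕ) :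
    (M.startNum n e : ℝ) = 2 ^ (e + 1) * ∑ i ∈ Finset.range e, M.eventWeight n i := by
  rw [startNum, Finset.mul_sum, Nat.cast_sum]
  refine Finset.sum_congr rfl fun i hi => ?_
  rw [Finset.mem_range] at hi
  cases hk : M.eventKey n i with
  | none => simp [eventWeight, hk]
  | some k =>
    obtain ⟨p, hp, hev⟩ := eventKey_eq_some hk
    have hle : k.1 ≤ e := by
      have := length_le_of_event hev
      omega
    rw [eventWeight_eq hk]
    simp only [Option.map_some, Option.getD_some]
    push_cast
    have : (2 : ℝ) ^ (e + 1) = 2 ^ (e - k.1) * 2 ^ (k.1 + 1) := by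
      rw [← pow_add]; congr 1; omega
    rw [this, one_div, inv_pow]
    field_simp

lemma sum_programs_le_one (hM : M.PrefixFree) (n e : ℕ) :
    ∑ i ∈ Finset.range e, ((M.eventKey n i).map fun k => (1 / 2 : ℝ) ^ k.1).getD 0 ≤ 1 := by
  set S : Finset ℕ := (Finset.range e).filter fun i => (M.event n i).isSome
  set f : ℕ → List Bool := fun i => ((M.event n i).map Prod.fst).getD []
  have hf {i : ℕ} (hi : i ∈ S) : ∃ v, M.event n i = some (f i, v) := by
    obtain ⟨⟨p, v⟩, h⟩ := Option.isSome_iff_exists.1 (Finset.mem_filter.1 hi).2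
    exact ⟨v, by simp [f, h]⟩
  have hinj : Set.InjOn f S := by
    intro i hi j hj hij
    obtain ⟨v, hv⟩ := hf hi
    obtain ⟨v', hv'⟩ := hf hj
    rw [hij] at hv
    exact event_inj hv hv'
  have hk := kraft_of_prefixFree (S.image f) (by
    simp only [Finset.mem_image]
    rintro _ ⟨i, hi, rfl⟩ _ ⟨j, hj, rfl⟩ hp
    obtain ⟨v, hv⟩ := hf hi
    obtain ⟨v', hv'⟩ := hf hj
    exact hM ⟨v, outputs_of_event hv⟩ ⟨v', outputs_of_event hv'⟩ hp)
  rw [Finset.sum_image hinj] at hk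
  refine le_trans (le_of_eq ?_) hk
  rw [Finset.sum_filter]
  refine Finset.sum_congr rfl fun i _ => ?_
  cases h : M.event n i with
  | none => simp [eventKey, h]
  | some a => simp [eventKey, h, f]

lemma sum_eventWeight_le_one (hM : M.PrefixFree) (n e : ℕ) :
    ∑ i ∈ Finset.range e, M.eventWeight n i ≤ 1 := by
  refine le_trans ?_ (sum_programs_le_one hM n e)
  rw [← Finset.sum_fiberwise_of_maps_to (g := M.eventKey n)
    (t := (Finset.range e).image (M.eventKey n)) fun i hi => Finset.mem_image_of_mem _ hi,
    ← Finset.sum_fiberwise_of_maps_to (g := M.eventKey n)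
    (t := (Finset.range e).image (M.eventKey n)) fun i hi => Finset.mem_image_of_mem _ hi]
  refine Finset.sum_le_sum fun o _ => ?_
  cases o with
  | none =>
    refine Finset.sum_le_sum fun i hi => ?_
    simp [eventWeight, (Finset.mem_filter.1 hi).2]
  | some k =>
    have hr : ∑ i ∈ Finset.range e with M.eventKey n i = some k,
        ((M.eventKey n i).map fun k => (1 / 2 : ℝ) ^ k.1).getD 0 =
          ∑ i ∈ Finset.range e with M.eventKey n i = some k, (1 / 2 : ℝ) ^ k.1 :=
      Finset.sum_congr rfl fun i hi => by simp [(Finset.mem_filter.1 hi).2]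
    rw [Finset.sum_congr rfl fun i hi => eventWeight_eq (Finset.mem_filter.1 hi).2,
      sum_rank n k (fun r => (pow2Weight r : ℝ) * (1 / 2) ^ (k.1 + 1)), hr,
      sum_rank n k (fun _ => (1 / 2 : ℝ) ^ k.1), ← Finset.sum_mul, Finset.sum_const,
      Finset.card_range, nsmul_eq_mul, pow_succ]
    have h : (∑ r ∈ Finset.range (M.rank n k e), (pow2Weight r : ℝ)) ≤ 2 * M.rank n k e := by
      exact_mod_cast sum_pow2Weight_le (M.rank n k e)
    have h2 : (0 : ℝ) ≤ (1 / 2) ^ k.1 := by positivity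
    nlinarith

end Machine

namespace Machine

variable (M : Machine)

/-- The value of the `e`-th event, provided that `q` is the Shannon–Fano–Elias code word
allotted to that event. -/
def codeValue (q : List Bool) (_y n e : ℕ) : Option ℕ :=
  (M.eventKey n e).bind fun k =>
    if 2 ^ q.length * (M.rank n k e + 1) = 2 ^ (k.1 + 2) then
      if M.startNum n e * 2 ^ q.length ≤ bitVal q * 2 ^ (e + 1) then
        if bitVal q * 2 ^ (e + 1) + 1 ≤ M.startNum n e * 2 ^ q.length + 2 ^ (e + 1) then some k.2
        else none
      else none
    else none

lemma codeValue_computable :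
    Computable fun q : (List Bool × ℕ × ℕ) × ℕ => M.codeValue q.1.1 q.1.2.1 q.1.2.2 q.2 := by
  have hn : Computable fun q : ((List Bool × ℕ × ℕ) × ℕ) × ℕ × ℕ => q.1.1.2.2 :=
    Computable.snd.comp (Computable.snd.comp (Computable.fst.comp Computable.fst))
  have he : Computable fun q : ((List Bool × ℕ × ℕ) × ℕ) × ℕ × ℕ => q.1.2 :=
    Computable.snd.comp Computable.fst
  have hq : Computable fun q : ((List Bool × ℕ × ℕ) × ℕ) × ℕ × ℕ => q.1.1.1 :=
    Computable.fst.comp (Computable.fst.comp Computable.fst)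
  have hr := M.rank_computable.comp (Computable.pair hn (Computable.pair Computable.snd he))
  have hs := M.startNum_computable.comp hn he
  have h2 {f : ((List Bool × ℕ × ℕ) × ℕ) × ℕ × ℕ → ℕ} (hf : Computable f) :
      Computable fun a => 2 ^ f a := nat_pow_primrec.to_comp.comp (Computable.const 2) hf
  have hl := h2 (Computable.list_length.comp hq)
  have hv := Primrec.nat_mul.to_comp.comp (bitVal_primrec.to_comp.comp hq)
    (h2 (Computable.succ.comp he))
  have hz := Primrec.nat_mul.to_comp.comp hs hl
  refine Computable.option_bind (M.eventKey_computable.comp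
    (Computable.snd.comp (Computable.snd.comp Computable.fst)) Computable.snd) ?_
  refine Computable.ite_eq (Primrec.nat_mul.to_comp.comp hl (Computable.succ.comp hr))
    (h2 (Computable.succ.comp (Computable.succ.comp (Computable.fst.comp Computable.snd))))
    (Computable.ite_le hz hv (Computable.ite_le (Computable.succ.comp hv)
      (Primrec.nat_add.to_comp.comp hz (h2 (Computable.succ.comp he)))
      (Computable.option_some.comp (Computable.snd.comp Computable.snd)) (Computable.const none))
      (Computable.const none)) (Computable.const none)

variable {M}

lemma codeValue_eq_some_iff {q : List Bool} {y n e v : ℕ} :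
    M.codeValue q y n e = some v ↔ ∃ k, M.eventKey n e = some k ∧
      2 ^ q.length * (M.rank n k e + 1) = 2 ^ (k.1 + 2) ∧
      (∑ i ∈ Finset.range e, M.eventWeight n i) * 2 ^ q.length ≤ bitVal q ∧
      bitVal q < (∑ i ∈ Finset.range e, M.eventWeight n i) * 2 ^ q.length + 1 ∧ k.2 = v := by
  have hpos : (0 : ℝ) < 2 ^ (e + 1) := by positivity
  have h1 : M.startNum n e * 2 ^ q.length ≤ bitVal q * 2 ^ (e + 1) ↔
      (∑ i ∈ Finset.range e, M.eventWeight n i) * 2 ^ q.length ≤ bitVal q := by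
    rw [← Nat.cast_le (α := ℝ)]
    push_cast
    rw [startNum_eq, mul_assoc, mul_comm (bitVal q : ℝ), mul_le_mul_iff_right₀ hpos]
  have h2 : bitVal q * 2 ^ (e + 1) + 1 ≤ M.startNum n e * 2 ^ q.length + 2 ^ (e + 1) ↔
      bitVal q < (∑ i ∈ Finset.range e, M.eventWeight n i) * 2 ^ q.length + 1 := by
    rw [Nat.add_one_le_iff, ← Nat.cast_lt (α := ℝ)]
    push_cast
    rw [startNum_eq, mul_assoc, mul_comm (bitVal q : ℝ), ← mul_add_one,
      mul_lt_mul_iff_right₀ hpos]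
  simp only [codeValue, Option.bind_eq_some_iff, h1, h2]
  refine exists_congr fun k => and_congr_right fun _ => ?_
  split_ifs <;> simp_all

lemma eventWeight_mul_of_code {q : List Bool} {n e : ℕ} {k : ℕ × ℕ}
    (hk : M.eventKey n e = some k) (h : 2 ^ q.length * (M.rank n k e + 1) = 2 ^ (k.1 + 2)) :
    M.eventWeight n e * 2 ^ q.length = 2 := by
  obtain ⟨i, -, hi⟩ := (Nat.dvd_prime_pow Nat.prime_two).1 (Dvd.intro_left _ h)
  rw [eventWeight_eq hk, pow2Weight_of_eq hi]
  have h' : (2 : ℝ) ^ q.length * (M.rank n k e + 1 : ℕ) = 2 ^ (k.1 + 1) * 2 := by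
    rw [← pow_succ]
    exact_mod_cast h
  rw [mul_right_comm, mul_comm _ ((2 : ℝ) ^ q.length), h', one_div, inv_pow]
  field_simp

lemma sum_eventWeight_add_le {n e e' : ℕ} (h : e < e') :
    ∑ i ∈ Finset.range e, M.eventWeight n i + M.eventWeight n e ≤
      ∑ i ∈ Finset.range e', M.eventWeight n i := by
  rw [← Finset.sum_range_succ]
  exact Finset.sum_le_sum_of_subset_of_nonneg (Finset.range_mono h)
    fun i _ _ => eventWeight_nonneg n i

lemma codeValue_prefixFree {q q' : List Bool} {y n e e' v v' : ℕ}
    (h : M.codeValue q y n e = some v) (h' : M.codeValue q' y n e' = some v')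
    (hp : q <+: q') : e = e' ∧ q = q' := by
  obtain ⟨k, hk, hl, hlo, hhi, -⟩ := codeValue_eq_some_iff.1 h
  obtain ⟨k', hk', hl', hlo', hhi', -⟩ := codeValue_eq_some_iff.1 h'
  have hw := eventWeight_mul_of_code hk hl
  have hw' := eventWeight_mul_of_code hk' hl'
  obtain ⟨s, rfl⟩ := hp
  have hs : (bitVal s : ℝ) < 2 ^ s.length := by exact_mod_cast bitVal_lt s
  have hs0 : (0 : ℝ) ≤ bitVal s := by positivity
  have hpos : (0 : ℝ) < 2 ^ s.length := by positivity
  have hqpos : (0 : ℝ) < 2 ^ q.length := by positivity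
  rw [bitVal_append] at hlo' hhi'
  rw [List.length_append, pow_add] at hlo' hhi' hw'
  push_cast at hlo' hhi'
  rcases lt_trichotomy e e' with hlt | rfl | hlt
  · exfalso
    have h1 := mul_le_mul_of_nonneg_right (sum_eventWeight_add_le (M := M) (n := n) hlt) hqpos.le
    rw [add_mul, hw] at h1
    have h2 : (bitVal q + 1 : ℝ) ≤
        (∑ i ∈ Finset.range e', M.eventWeight n i) * 2 ^ q.length := by linarith
    have h3 := mul_le_mul_of_nonneg_right h2 hpos.le
    nlinarith
  · refine ⟨rfl, ?_⟩
    rw [hk] at hk'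
    obtain rfl := Option.some.inj hk'
    have := Nat.pow_right_injective le_rfl
      (Nat.eq_of_mul_eq_mul_right (Nat.succ_pos _) (hl.trans hl'.symm))
    rw [List.length_append] at this
    rw [List.eq_nil_of_length_eq_zero (by omega : s.length = 0), List.append_nil]
  · exfalso
    have h1 := mul_le_mul_of_nonneg_right (sum_eventWeight_add_le (M := M) (n := n) hlt)
      (mul_pos hqpos hpos).le
    rw [add_mul, hw'] at h1
    have h3 := mul_le_mul_of_nonneg_right hlo hpos.le
    nlinarith

lemma exists_codeValue (hM : M.PrefixFree) {n e j : ℕ} {k : ℕ × ℕ}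
    (hk : M.eventKey n e = some k) (hj : M.rank n k e + 1 = 2 ^ j) (y : ℕ) :
    ∃ q : List Bool, q.length + j = k.1 + 2 ∧ M.codeValue q y n e = some k.2 := by
  have hle := sum_eventWeight_le_one hM n (e + 1)
  rw [Finset.sum_range_succ] at hle
  set A := ∑ i ∈ Finset.range e, M.eventWeight n i with hA
  have hA0 : 0 ≤ A := Finset.sum_nonneg fun i _ => eventWeight_nonneg n i
  have hjk : j ≤ k.1 + 1 := by
    have h1 : M.eventWeight n e ≤ 1 := by linarith
    rw [eventWeight_eq hk, pow2Weight_of_eq hj, hj, one_div, inv_pow, ← div_eq_mul_inv,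
      div_le_one (by positivity)] at h1
    have h2 : 2 ^ j ≤ 2 ^ (k.1 + 1) := by exact_mod_cast h1
    exact (Nat.pow_le_pow_iff_right Nat.one_lt_two).1 h2
  set m := k.1 + 2 - j with hm
  have hlen : 2 ^ m * (M.rank n k e + 1) = 2 ^ (k.1 + 2) := by
    rw [hj, ← pow_add]; congr 1; omega
  have hw : M.eventWeight n e * 2 ^ m = 2 := by
    have := eventWeight_mul_of_code (q := List.replicate m true) hk (by simpa using hlen)
    simpa using this
  have hx := Nat.ceil_lt_add_one (a := A * 2 ^ m) (by positivity)
  have hlt : ⌈A * 2 ^ m⌉₊ < 2 ^ m := by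
    have h1 := mul_le_mul_of_nonneg_right hle (by positivity : (0 : ℝ) ≤ 2 ^ m)
    rw [add_mul, hw] at h1
    have : (⌈A * 2 ^ m⌉₊ : ℝ) < 2 ^ m := by linarith
    exact_mod_cast this
  obtain ⟨q, hq, hv⟩ := exists_bitVal_eq m _ hlt
  refine ⟨q, by omega, codeValue_eq_some_iff.2 ⟨k, hk, by rw [hq]; exact hlen, ?_, ?_, rfl⟩⟩
  · rw [hq, hv]; exact Nat.le_ceil _
  · rw [hq, hv]; exact hx

lemma C_le {p : List Bool} {y n v : ℕ} (h : M.Outputs p y n v) : M.C v y n ≤ p.length :=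
  Nat.sInf_le ⟨p, rfl, h⟩

lemma POptimal.exists_program (hM : M.POptimal) (v y n : ℕ) :
    ∃ q : List Bool, q.length = M.C v y n ∧ M.Outputs q y n v :=
  Nat.sInf_mem (s := {l | ∃ p : List Bool, p.length = l ∧ M.Outputs p y n v})
    (let ⟨p, hp⟩ := hM.2.1 v y n; ⟨p.length, p, rfl, hp⟩)

/-- A bounded number of programs have length within a constant of the shortest. -/
lemma POptimal.exists_rank_lt (hM : M.POptimal) (c : ℕ) : ∃ D, ∀ (n w e : ℕ) (p : List Bool),
    M.event n e = some (p, w) → p.length ≤ M.C w 0 n + c → M.rank n (p.length, w) e < D := by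
  obtain ⟨c₀, hc₀⟩ := hM.2.2 (search M.codeValue M.codeValue_computable) (by
    rintro p q y n ⟨v, hv⟩ ⟨v', hv'⟩ hpq
    obtain ⟨e, he⟩ := exists_of_search_outputs hv
    obtain ⟨e', he'⟩ := exists_of_search_outputs hv'
    exact (codeValue_prefixFree he he' hpq).2)
  refine ⟨2 ^ (c + c₀ + 3), fun n w e p he hp => ?_⟩
  by_contra! hr
  obtain ⟨i, -, hi, hri⟩ := exists_rank_eq
    (lt_of_lt_of_le (Nat.sub_lt (by positivity) one_pos) hr)
  obtain ⟨q, hq, hv⟩ := exists_codeValue (j := c + c₀ + 3) hM.1 hi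
    (by rw [hri]; exact Nat.sub_add_cancel Nat.one_le_two_pow) 0
  have hout := hc₀ q 0 n w (search_outputs_of_unique ⟨i, hv⟩ fun i' u hu => by
    obtain rfl := (codeValue_prefixFree hv hu List.prefix_rfl).1
    rw [hv] at hu
    exact (Option.some.inj hu).symm)
  simp only at hq
  omega

variable (M)

/-- Given a program `u` (coded by `y`) for some value, and a string `q` of length `D` coding a
pair `(δ, r)`, the program of length `u.length + δ` and rank `r` among the programs of
that length for the same value. -/
def selectProgram (D : ℕ) (q : List Bool) (y n s : ℕ) : Option ℕ :=
  if q.length = D then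
    (Encodable.decode (α := List Bool) y).bind fun u =>
      (M.event n s.unpair.2).bind fun a =>
        if M.step s.unpair.1 u 0 n = some a.2 then
          if a.1.length = u.length + (bitVal q).unpair.1 then
            if M.rank n (a.1.length, a.2) s.unpair.2 = (bitVal q).unpair.2 then
              some (Encodable.encode a.1)
            else none
          else none
        else none
  else none

lemma selectProgram_computable (D : ℕ) : Computable fun q : (List Bool × ℕ × ℕ) × ℕ =>
    M.selectProgram D q.1.1 q.1.2.1 q.1.2.2 q.2 := by
  have hq : Computable fun z : (((List Bool × ℕ × ℕ) × ℕ) × List Bool) × List Bool × ℕ =>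
      z.1.1.1.1 := Computable.fst.comp (Computable.fst.comp (Computable.fst.comp Computable.fst))
  have hn : Computable fun z : (((List Bool × ℕ × ℕ) × ℕ) × List Bool) × List Bool × ℕ =>
      z.1.1.1.2.2 := Computable.snd.comp (Computable.snd.comp
        (Computable.fst.comp (Computable.fst.comp Computable.fst)))
  have hs : Computable fun z : (((List Bool × ℕ × ℕ) × ℕ) × List Bool) × List Bool × ℕ =>
      z.1.1.2.unpair := Computable.unpair.comp (Computable.snd.comp
        (Computable.fst.comp Computable.fst))
  have hu : Computable fun z : (((List Bool × ℕ × ℕ) × ℕ) × List Bool) × List Bool × ℕ =>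
      z.1.2 := Computable.snd.comp Computable.fst
  have ha : Computable fun z : (((List Bool × ℕ × ℕ) × ℕ) × List Bool) × List Bool × ℕ =>
      z.2.1 := Computable.fst.comp Computable.snd
  have hv : Computable fun z : (((List Bool × ℕ × ℕ) × ℕ) × List Bool) × List Bool × ℕ =>
      z.2.2 := Computable.snd.comp Computable.snd
  have hb : Computable fun z : (((List Bool × ℕ × ℕ) × ℕ) × List Bool) × List Bool × ℕ =>
      (bitVal z.1.1.1.1).unpair := Computable.unpair.comp (bitVal_primrec.to_comp.comp hq)
  have hal : Computable fun z : (((List Bool × ℕ × ℕ) × ℕ) × List Bool) × List Bool × ℕ =>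
      z.2.1.length := Computable.list_length.comp ha
  have harg : Computable fun z : (((List Bool × ℕ × ℕ) × ℕ) × List Bool) × List Bool × ℕ =>
      ((z.1.1.1.2.2, (z.2.1.length, z.2.2), z.1.1.2.unpair.2) : ℕ × (ℕ × ℕ) × ℕ) :=
    Computable.pair hn (Computable.pair (Computable.pair hal hv) (Computable.snd.comp hs))
  have hrank := M.rank_computable.comp harg
  have hstep : Computable fun z : (((List Bool × ℕ × ℕ) × ℕ) × List Bool) × List Bool × ℕ =>
      M.step z.1.1.2.unpair.1 z.1.2 0 z.1.1.1.2.2 :=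
    M.step_computable (Computable.fst.comp hs) hu (Computable.const 0) hn
  have hin : Computable₂ fun (x : ((List Bool × ℕ × ℕ) × ℕ) × List Bool) (a : List Bool × ℕ) =>
      if M.step x.1.2.unpair.1 x.2 0 x.1.1.2.2 = some a.2 then
        if a.1.length = x.2.length + (bitVal x.1.1.1).unpair.1 then
          if M.rank x.1.1.2.2 (a.1.length, a.2) x.1.2.unpair.2 = (bitVal x.1.1.1).unpair.2 then
            some (Encodable.encode a.1)
          else none
        else none
      else none :=
    Computable.ite_eq hstep (Computable.option_some.comp hv) (Computable.ite_eq hal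
      (Primrec.nat_add.to_comp.comp (Computable.list_length.comp hu) (Computable.fst.comp hb))
      (Computable.ite_eq hrank (Computable.snd.comp hb)
        (Computable.option_some.comp (Computable.encode.comp ha)) (Computable.const none))
      (Computable.const none)) (Computable.const none)
  have hev : Computable fun x : ((List Bool × ℕ × ℕ) × ℕ) × List Bool =>
      M.event x.1.1.2.2 x.1.2.unpair.2 := M.event_computable.comp
    (Computable.snd.comp (Computable.snd.comp (Computable.fst.comp Computable.fst)))
    (Computable.snd.comp (Computable.unpair.comp (Computable.snd.comp Computable.fst)))
  have hdec : Computable fun x : (List Bool × ℕ × ℕ) × ℕ =>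
      (Encodable.decode (α := List Bool) x.1.2.1) := Computable.decode.comp
    (Computable.fst.comp (Computable.snd.comp Computable.fst))
  have hmid := Computable.option_bind hdec (Computable.option_bind hev hin).to₂
  have hlen : Computable fun x : (List Bool × ℕ × ℕ) × ℕ => x.1.1.length :=
    Computable.list_length.comp (Computable.fst.comp Computable.fst)
  exact Computable.ite_eq hlen (Computable.const D) hmid (Computable.const none)

variable {M}

lemma selectProgram_eq_some_iff {D : ℕ} {q : List Bool} {y n s x : ℕ} :
    M.selectProgram D q y n s = some x ↔ q.length = D ∧
      ∃ u, Encodable.decode (α := List Bool) y = some u ∧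
      ∃ p w, M.event n s.unpair.2 = some (p, w) ∧ M.step s.unpair.1 u 0 n = some w ∧
        p.length = u.length + (bitVal q).unpair.1 ∧
        M.rank n (p.length, w) s.unpair.2 = (bitVal q).unpair.2 ∧ Encodable.encode p = x := by
  unfold selectProgram
  split_ifs with h
  · simp only [h, true_and, Option.bind_eq_some_iff, Prod.exists]
    refine exists_congr fun u => and_congr_right fun _ => exists_congr fun p =>
      exists_congr fun w => and_congr_right fun _ => ?_
    split_ifs <;> simp_all
  · simp [h]

lemma rank_inj {n e e' : ℕ} {k : ℕ × ℕ} (h : M.eventKey n e = some k)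
    (h' : M.eventKey n e' = some k) (hr : M.rank n k e = M.rank n k e') : e = e' := by
  rcases lt_trichotomy e e' with hlt | heq | hlt
  · exact absurd hr (rank_lt_rank h hlt).ne
  · exact heq
  · exact absurd hr (rank_lt_rank h' hlt).ne'

lemma eventKey_of_event {n e w : ℕ} {p : List Bool} (h : M.event n e = some (p, w)) :
    M.eventKey n e = some (p.length, w) := by
  simp [eventKey, h]

lemma selectProgram_unique {D : ℕ} {q : List Bool} {y n s s' x x' : ℕ}
    (h : M.selectProgram D q y n s = some x) (h' : M.selectProgram D q y n s' = some x') :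
    x = x' := by
  obtain ⟨-, u, hu, p, w, he, hs, hl, hr, rfl⟩ := selectProgram_eq_some_iff.1 h
  obtain ⟨-, u', hu', p', w', he', hs', hl', hr', rfl⟩ := selectProgram_eq_some_iff.1 h'
  obtain rfl := Option.some.inj (hu.symm.trans hu')
  obtain rfl := Outputs.unique ⟨_, hs⟩ ⟨_, hs'⟩
  have hlen := hl.trans hl'.symm
  rw [← hlen] at hr'
  have := rank_inj (eventKey_of_event he) (hlen ▸ eventKey_of_event he') (hr.trans hr'.symm)
  rw [this, he'] at he
  simp only [Option.some.injEq, Prod.mk.injEq, and_true] at he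
  rw [he]

end Machine

/-- if `Φ(p)↓ = w` and `l(p) ≤ K(w) + O(1)`, then `w* → p`. -/
theorem stmt_0 (Φ : Machine) (hΦ : Φ.POptimal) :
    ∀ c : ℕ, ∃ c' : ℕ, ∀ (n w : ℕ) (p wstar : List Bool),
      Φ.Outputs p 0 n w → p.length ≤ Φ.C w 0 n + c →
      Φ.ShortestProg wstar w 0 n →
      Φ.Computes c' (Encodable.encode wstar) n (Encodable.encode p) := by
  intro c
  obtain ⟨R, hR⟩ := hΦ.exists_rank_lt c
  obtain ⟨D, hD⟩ : ∃ D, Nat.pair c R < 2 ^ D := ⟨_, Nat.lt_two_pow_self⟩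
  obtain ⟨c₀, hc₀⟩ := hΦ.2.2
    (Machine.search (Φ.selectProgram D) (Φ.selectProgram_computable D)) (by
    rintro p q y n ⟨v, hv⟩ ⟨v', hv'⟩ hpq
    obtain ⟨s, hs⟩ := Machine.exists_of_search_outputs hv
    obtain ⟨s', hs'⟩ := Machine.exists_of_search_outputs hv'
    exact hpq.eq_of_length ((Machine.selectProgram_eq_some_iff.1 hs).1.trans
      (Machine.selectProgram_eq_some_iff.1 hs').1.symm))
  refine ⟨D + c₀, fun n w p wstar hp hlen hw => ?_⟩
  obtain ⟨⟨t, ht⟩, hwl⟩ := hw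
  obtain ⟨e, he⟩ := Machine.exists_event hp
  have hr := hR n w e p he hlen
  have hC := Machine.C_le hp
  obtain ⟨q, hq, hv⟩ := exists_bitVal_eq D
    (Nat.pair (p.length - wstar.length) (Φ.rank n (p.length, w) e))
    (((StrictMono.monotone fun _ _ => Nat.pair_lt_pair_left _)
      (by omega : p.length - wstar.length ≤ c)).trans_lt
      ((Nat.pair_lt_pair_right c hr).trans hD))
  have hsel : Φ.selectProgram D q (Encodable.encode wstar) n (Nat.pair t e) =
      some (Encodable.encode p) := by
    refine Machine.selectProgram_eq_some_iff.2 ⟨hq, wstar, Encodable.encodek _, p, w, ?_⟩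
    simp only [hv, Nat.unpair_pair]
    exact ⟨he, ht, by omega, trivial, trivial⟩
  have hle := hc₀ q (Encodable.encode wstar) n (Encodable.encode p)
    (Machine.search_outputs_of_unique ⟨_, hsel⟩ fun i u hu => Machine.selectProgram_unique hu hsel)
  obtain ⟨r, hrl, hout⟩ := hΦ.exists_program (Encodable.encode p) (Encodable.encode wstar) n
  exact ⟨r, by omega, hout⟩
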